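/- (Nazarov–Yuditskii, case C > 0) Let (γ_k)_{k≥1} be a strictly increasing sequence of positive real numbers tending to +∞, let C > 0, and let (χ_k)_{k≥1} be a sequence of positive real numbers with χ_k < γ_k < χ_{k+1} for all k. Then the following are equivalent: (i) there exist positive weights (ν_k)_{k≥1} with Σ_k ν_k/γ_k < ∞ such that Σ_k ν_k/(γ_k − χ_j) = C for every j ≥ 1; (ii) Σ_{k=1}^{∞} (γ_k/χ_k − 1) < ∞. -/

import Mathlib

open Finset Filter Topology

/-- The coefficient at `1 / (x j - t)` in the partial fraction expansion of
`∏ i ∈ s, (y i - t) / (x i - t)`. The factor with `i = j` equals `1` since `a / 0 = 0`. -/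
noncomputable def partialFractionCoeff (x y : ℕ → ℝ) (s : Finset ℕ) (j : ℕ) : ℝ :=
  (y j - x j) * ∏ i ∈ s, (1 + (y i - x i) / (x i - x j))

theorem prod_eq_one_add_sum_partialFractionCoeff {x : ℕ → ℝ} (hx : Function.Injective x)
    (y : ℕ → ℝ) (s : Finset ℕ) (t : ℝ) (ht : ∀ i ∈ s, x i ≠ t) :
    ∏ i ∈ s, (1 + (y i - x i) / (x i - t)) =
      1 + ∑ j ∈ s, partialFractionCoeff x y s j / (x j - t) := by
  induction s using Finset.induction_on generalizing t with
  | empty => simp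
  | insert a s ha ih =>
    have ht' : ∀ i ∈ s, x i ≠ t := fun i hi => ht i (mem_insert_of_mem hi)
    have hat : x a - t ≠ 0 := sub_ne_zero.2 (ht a (mem_insert_self a s))
    have hxa : ∀ i ∈ s, x i ≠ x a := fun i hi h => ha (hx h ▸ hi)
    have ha_coeff : partialFractionCoeff x y (insert a s) a =
        (y a - x a) * (1 + ∑ j ∈ s, partialFractionCoeff x y s j / (x j - x a)) := by
      rw [partialFractionCoeff, prod_insert ha, ih _ hxa]
      simp
    have hs : ∑ j ∈ s, partialFractionCoeff x y (insert a s) j / (x j - t) =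
        ∑ j ∈ s, (partialFractionCoeff x y s j / (x j - t) * (1 + (y a - x a) / (x a - t)) -
          (y a - x a) / (x a - t) * (partialFractionCoeff x y s j / (x j - x a))) := by
      refine sum_congr rfl fun j hj => ?_
      have h1 : x j - t ≠ 0 := sub_ne_zero.2 (ht' j hj)
      have h2 : x j - x a ≠ 0 := sub_ne_zero.2 (hxa j hj)
      have h3 : x a - x j ≠ 0 := sub_ne_zero.2 (hxa j hj).symm
      have h4 : partialFractionCoeff x y (insert a s) j =
          partialFractionCoeff x y s j * (1 + (y a - x a) / (x a - x j)) := by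
        simp only [partialFractionCoeff, prod_insert ha]
        ring
      rw [h4]
      have h5 : (y a - x a) / (x a - x j) = -((y a - x a) / (x j - x a)) := by
        rw [← neg_sub (x j) (x a), div_neg]
      rw [h5]
      field_simp
      ring
    rw [prod_insert ha, sum_insert ha, ih t ht', hs, ha_coeff, sum_sub_distrib, ← sum_mul,
      ← mul_sum]
    ring

theorem one_add_sum_le_prod_one_add_of_nonneg {u : ℕ → ℝ} (s : Finset ℕ) (hu : ∀ i ∈ s, 0 ≤ u i) :
    1 + ∑ i ∈ s, u i ≤ ∏ i ∈ s, (1 + u i) := by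
  induction s using Finset.induction_on with
  | empty => simp
  | insert a s ha ih =>
    have hs := ih fun i hi => hu i (mem_insert_of_mem hi)
    have h0 := hu a (mem_insert_self a s)
    have h1 : 0 ≤ ∑ i ∈ s, u i := sum_nonneg fun i hi => hu i (mem_insert_of_mem hi)
    rw [prod_insert ha, sum_insert ha]
    nlinarith [mul_nonneg h0 h1, mul_le_mul_of_nonneg_left hs h0]

theorem one_sub_sum_le_prod_one_sub {u : ℕ → ℝ} (s : Finset ℕ) (h0 : ∀ i ∈ s, 0 ≤ u i)
    (h1 : ∀ i ∈ s, u i ≤ 1) : 1 - ∑ i ∈ s, u i ≤ ∏ i ∈ s, (1 - u i) := by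
  induction s using Finset.induction_on with
  | empty => simp
  | insert a s ha ih =>
    have hs := ih (fun i hi => h0 i (mem_insert_of_mem hi)) fun i hi => h1 i (mem_insert_of_mem hi)
    have ha0 := h0 a (mem_insert_self a s)
    have ha1 := h1 a (mem_insert_self a s)
    have hs0 : 0 ≤ ∑ i ∈ s, u i := sum_nonneg fun i hi => h0 i (mem_insert_of_mem hi)
    rw [prod_insert ha, sum_insert ha]
    nlinarith [mul_nonneg ha0 hs0, mul_le_mul_of_nonneg_left hs (sub_nonneg.2 ha1)]

section Interlacing

variable {γ χ : ℕ → ℝ}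

theorem strictMono_of_interlacing (hint : ∀ k, χ k < γ k ∧ γ k < χ (k + 1)) : StrictMono χ :=
  strictMono_nat_of_lt_succ fun k => (hint k).1.trans (hint k).2

theorem lt_of_interlacing_of_le (hint : ∀ k, χ k < γ k ∧ γ k < χ (k + 1)) {i j : ℕ}
    (hij : i ≤ j) : χ i < γ j :=
  ((strictMono_of_interlacing hint).monotone hij).trans_lt (hint j).1

theorem lt_of_interlacing_of_lt (hint : ∀ k, χ k < γ k ∧ γ k < χ (k + 1)) {i j : ℕ}
    (hij : i < j) : γ i < χ j :=
  (hint i).2.trans_le ((strictMono_of_interlacing hint).monotone hij)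

theorem ne_of_interlacing (hint : ∀ k, χ k < γ k ∧ γ k < χ (k + 1)) (i j : ℕ) : γ i ≠ χ j := by
  rcases lt_or_ge i j with h | h
  · exact (lt_of_interlacing_of_lt hint h).ne
  · exact (lt_of_interlacing_of_le hint h).ne'

theorem summable_of_exists_weights (hγpos : ∀ k, 0 < γ k) {C : ℝ} (hC : 0 < C)
    (hχpos : ∀ k, 0 < χ k) (hint : ∀ k, χ k < γ k ∧ γ k < χ (k + 1)) {ν : ℕ → ℝ}
    (hν : ∀ k, 0 < ν k) (hνs : Summable fun k => ν k / γ k)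
    (hνC : ∀ j, (∑' k, ν k / (γ k - χ j)) = C) : Summable fun k => γ k / χ k - 1 := by
  have hχ := strictMono_of_interlacing hint
  have hsum : ∀ j, Summable fun k => ν k / (γ k - χ j) := by
    intro j
    by_contra h
    exact hC.ne' ((hνC j).symm.trans (tsum_eq_zero_of_not_summable h))
  set S := ∑' k, ν k / γ k with hS
  have hlt : ∀ k, ν k / γ k < ν k / (γ k - χ 0) := fun k =>
    div_lt_div_of_pos_left (hν k) (sub_pos.2 (lt_of_interlacing_of_le hint (Nat.zero_le k)))
      (sub_lt_self _ (hχpos 0))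
  have hSC : S < C := by
    rw [← hνC 0]
    exact hνs.tsum_lt_tsum (fun k => (hlt k).le) (hlt 0) (hsum 0)
  have hterm : ∀ k, 0 ≤ γ k / χ k - 1 := fun k => by
    rw [sub_nonneg, one_le_div (hχpos k)]
    exact (hint k).1.le
  refine summable_of_sum_range_le (c := S / (C - S)) hterm fun M => ?_
  set b := partialFractionCoeff χ γ (range M)
  set T := ∑ j ∈ range M, b j / χ j with hT
  have hbpos : ∀ j, 0 < b j := by
    intro j
    refine mul_pos (sub_pos.2 (hint j).1) (prod_pos fun i _ => ?_)
    rcases lt_trichotomy i j with h | rfl | h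
    · have h1 : 0 < χ j - χ i := sub_pos.2 (hχ h)
      have h2 := lt_of_interlacing_of_lt hint h
      rw [← neg_sub (χ j), div_neg, ← sub_eq_add_neg, sub_pos, div_lt_one h1]
      linarith
    · simp
    · have h1 : 0 < χ i - χ j := sub_pos.2 (hχ h)
      have := div_pos (sub_pos.2 (hint i).1) h1
      linarith
  have hle : ∑ i ∈ range M, (γ i / χ i - 1) ≤ T := by
    have h := prod_eq_one_add_sum_partialFractionCoeff hχ.injective γ (range M) 0
      fun i _ => (hχpos i).ne'
    have h' := one_add_sum_le_prod_one_add_of_nonneg (range M) fun i _ => hterm i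
    have h'' : ∏ i ∈ range M, (1 + (γ i / χ i - 1)) =
        ∏ i ∈ range M, (1 + (γ i - χ i) / (χ i - 0)) :=
      prod_congr rfl fun i _ => by rw [sub_zero, sub_div, div_self (hχpos i).ne']
    simp only [sub_zero] at h h''
    linarith
  have hpole : ∀ k, ∑ j ∈ range M, b j / χ j * (ν k / (γ k - χ j)) ≤ (T + 1) * (ν k / γ k) := by
    intro k
    have h := prod_eq_one_add_sum_partialFractionCoeff hχ.injective γ (range M) (γ k)
      fun i _ => (ne_of_interlacing hint k i).symm
    have h0 : 0 ≤ ∏ i ∈ range M, (1 + (γ i - χ i) / (χ i - γ k)) := by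
      refine prod_nonneg fun i _ => ?_
      rcases lt_or_ge k i with hki | hki
      · have h1 : 0 < χ i - γ k := sub_pos.2 (lt_of_interlacing_of_lt hint hki)
        have := div_pos (sub_pos.2 (hint i).1) h1
        linarith
      · have h1 : 0 < γ k - χ i := sub_pos.2 (lt_of_interlacing_of_le hint hki)
        have h2 : γ i ≤ γ k := by
          rcases hki.lt_or_eq with h3 | rfl
          · exact ((lt_of_interlacing_of_lt hint h3).trans (hint k).1).le
          · exact le_rfl
        rw [← neg_sub (γ k), div_neg, ← sub_eq_add_neg, sub_nonneg, div_le_one h1]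
        linarith
    have h1 : ∑ j ∈ range M, b j / χ j * (ν k / (γ k - χ j)) =
        ν k / γ k * (T - ∑ j ∈ range M, b j / (χ j - γ k)) := by
      rw [hT, ← sum_sub_distrib, mul_sum]
      refine sum_congr rfl fun j _ => ?_
      have h2 := (hχpos j).ne'
      have h3 := (hγpos k).ne'
      have h4 : γ k - χ j ≠ 0 := sub_ne_zero.2 (ne_of_interlacing hint k j)
      rw [← neg_sub (γ k), div_neg]
      field_simp
      ring
    rw [h1, mul_comm]
    have h2 : 0 ≤ ν k / γ k := (div_pos (hν k) (hγpos k)).le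
    exact mul_le_mul_of_nonneg_right (by linarith) h2
  have hCT : T * C ≤ (T + 1) * S := by
    have h1 : T * C = ∑' k, ∑ j ∈ range M, b j / χ j * (ν k / (γ k - χ j)) := by
      rw [Summable.tsum_finsetSum fun j _ => (hsum j).mul_left _, hT, sum_mul]
      exact sum_congr rfl fun j _ => by rw [tsum_mul_left, hνC]
    rw [h1, hS, ← tsum_mul_left]
    exact (summable_sum fun j _ => (hsum j).mul_left _).tsum_le_tsum hpole (hνs.mul_left _)
  refine hle.trans ?_
  rw [le_div_iff₀ (sub_pos.2 hSC)]
  linarith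

theorem exists_weights_of_summable (hγ : StrictMono γ) (hγpos : ∀ k, 0 < γ k)
    (hγtop : Tendsto γ atTop atTop) (hχpos : ∀ k, 0 < χ k)
    (hint : ∀ k, χ k < γ k ∧ γ k < χ (k + 1)) (hs : Summable fun k => γ k / χ k - 1) :
    ∃ a : ℕ → ℝ, (∀ k, 0 < a k) ∧ (Summable fun k => a k / γ k) ∧
      ∀ j, HasSum (fun k => a k / (γ k - χ j)) 1 := by
  have hd : ∀ k, 0 < γ k - χ k := fun k => sub_pos.2 (hint k).1
  have hdom : ∀ k, (γ k - χ k) / γ k ≤ γ k / χ k - 1 := fun k => by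
    have : γ k / χ k - 1 = (γ k - χ k) / χ k := by rw [sub_div, div_self (hχpos k).ne']
    rw [this]
    exact div_le_div_of_nonneg_left (hd k).le (hχpos k) (hint k).1.le
  have hsγ : Summable fun k => (γ k - χ k) / γ k :=
    hs.of_nonneg_of_le (fun k => (div_pos (hd k) (hγpos k)).le) hdom
  have hp : ∀ k i, 0 < 1 + (χ i - γ i) / (γ i - γ k) := by
    intro k i
    rcases lt_trichotomy i k with h | rfl | h
    · have h1 : 0 < γ k - γ i := sub_pos.2 (hγ h)
      have := div_pos (hd i) h1
      rw [← neg_sub (γ i), ← neg_sub (γ k) (γ i), neg_div_neg_eq]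
      linarith
    · simp
    · have h1 : 0 < γ i - γ k := sub_pos.2 (hγ h)
      have h2 := lt_of_interlacing_of_lt hint h
      rw [← neg_sub (γ i), neg_div, ← sub_eq_add_neg, sub_pos, div_lt_one h1]
      linarith
  have hps : ∀ k, Summable fun i => (χ i - γ i) / (γ i - γ k) := by
    intro k
    refine (hsγ.mul_left 2).of_norm_bounded_eventually_nat ?_
    filter_upwards [hγtop.eventually_ge_atTop (2 * γ k)] with i hi
    have h1 : 0 < γ i - γ k := by linarith [hγpos k]
    rw [Real.norm_eq_abs, abs_div, abs_sub_comm, abs_of_pos (hd i), abs_of_pos h1,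
      div_le_iff₀ h1, mul_div_assoc', div_mul_eq_mul_div, le_div_iff₀ (hγpos i)]
    nlinarith [hd i]
  set c : ℕ → ℕ → ℝ := fun N k =>
    (γ k - χ k) * ∏ i ∈ range N, (1 + (χ i - γ i) / (γ i - γ k)) with hc
  have hcpos : ∀ N k, 0 < c N k := fun N k => mul_pos (hd k) (prod_pos fun i _ => hp k i)
  have hexpand : ∀ N t, (∀ i, γ i ≠ t) →
      ∑ k ∈ range N, c N k / (γ k - t) = 1 - ∏ i ∈ range N, (1 + (χ i - γ i) / (γ i - t)) := by
    intro N t ht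
    rw [prod_eq_one_add_sum_partialFractionCoeff hγ.injective χ (range N) t fun i _ => ht i,
      sub_add_cancel_left, ← sum_neg_distrib]
    refine sum_congr rfl fun k _ => ?_
    rw [partialFractionCoeff, hc, ← neg_div, ← neg_mul, neg_sub]
  set a : ℕ → ℝ := fun k => (γ k - χ k) * ∏' i, (1 + (χ i - γ i) / (γ i - γ k))
  have hapos : ∀ k, 0 < a k := by
    intro k
    refine mul_pos (hd k) ?_
    rw [← Real.rexp_tsum_eq_tprod (hp k) (Real.summable_log_one_add_of_summable (hps k))]
    exact Real.exp_pos _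
  have hlim : ∀ k, Tendsto (fun N => c N k) atTop (𝓝 (a k)) := fun k =>
    (Real.multipliable_one_add_of_summable (hps k)).hasProd.tendsto_prod_nat.const_mul _
  have hsuma : Summable fun k => a k / γ k := by
    refine summable_of_sum_range_le (c := 1) (fun k => (div_pos (hapos k) (hγpos k)).le)
      fun m => ?_
    refine le_of_tendsto (tendsto_finsetSum (range m) fun k _ => (hlim k).div_const (γ k)) ?_
    filter_upwards [eventually_ge_atTop m] with N hN
    have h1 := hexpand N 0 fun i => (hγpos i).ne'
    simp only [sub_zero] at h1
    have h2 : 0 ≤ ∏ i ∈ range N, (1 + (χ i - γ i) / γ i) := prod_nonneg fun i _ => by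
      rw [sub_div, div_self (hγpos i).ne', add_sub_cancel]
      exact (div_pos (hχpos i) (hγpos i)).le
    calc ∑ k ∈ range m, c N k / γ k ≤ ∑ k ∈ range N, c N k / γ k :=
          sum_le_sum_of_subset_of_nonneg (range_mono hN)
            fun k _ _ => (div_pos (hcpos N k) (hγpos k)).le
      _ ≤ 1 := by linarith
  refine ⟨a, hapos, hsuma, fun j => ?_⟩
  have hsumj : Summable fun k => a k / (γ k - χ j) := by
    refine (hsuma.mul_left 2).of_norm_bounded_eventually_nat ?_
    filter_upwards [hγtop.eventually_ge_atTop (2 * χ j)] with k hk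
    have h1 : 0 < γ k - χ j := by linarith [hχpos j]
    rw [Real.norm_eq_abs, abs_div, abs_of_pos (hapos k), abs_of_pos h1,
      div_le_iff₀ h1, mul_div_assoc', div_mul_eq_mul_div, le_div_iff₀ (hγpos k)]
    nlinarith [hapos k]
  rw [hsumj.hasSum_iff_tendsto_nat, Metric.tendsto_atTop]
  intro ε hε
  have hdecay : Tendsto (fun R : ℝ => ∑' k, (γ k - χ k) / (γ k + R)) atTop (𝓝 0) := by
    have h := tendsto_tsum_of_dominated_convergence (𝓕 := atTop)
      (f := fun (R : ℝ) k => (γ k - χ k) / (γ k + R)) (g := fun _ => 0) hsγ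
      (fun k => (tendsto_atTop_add_const_left _ (γ k) tendsto_id).const_div_atTop (γ k - χ k)) ?_
    · simpa using h
    · filter_upwards [eventually_ge_atTop 0] with R hR k
      have h1 : 0 < γ k + R := add_pos_of_pos_of_nonneg (hγpos k) hR
      rw [Real.norm_of_nonneg (div_pos (hd k) h1).le]
      exact div_le_div_of_nonneg_left (hd k).le (hγpos k) (by linarith)
  obtain ⟨R, hRε, hR⟩ := ((hdecay.eventually_lt_const (show 0 < ε / 8 by positivity)).and
    (eventually_ge_atTop 0)).exists
  have hγR : ∀ k, 0 < γ k + R := fun k => add_pos_of_pos_of_nonneg (hγpos k) hR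
  have hsR : Summable fun k => (γ k - χ k) / (γ k + R) :=
    hsγ.of_nonneg_of_le (fun k => (div_pos (hd k) (hγR k)).le) fun k =>
      div_le_div_of_nonneg_left (hd k).le (hγpos k) (by linarith)
  have hmass : ∀ N, ∑ k ∈ range N, c N k / (γ k + R) ≤ ε / 8 := by
    intro N
    have h1 := hexpand N (-R) fun i => by linarith [hγR i]
    simp only [sub_neg_eq_add] at h1
    have h2 := one_sub_sum_le_prod_one_sub (u := fun i => (γ i - χ i) / (γ i + R)) (range N)
      (fun i _ => (div_pos (hd i) (hγR i)).le)
      fun i _ => (div_le_one (hγR i)).2 (by linarith [hχpos i])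
    have h3 : ∏ i ∈ range N, (1 - (γ i - χ i) / (γ i + R)) =
        ∏ i ∈ range N, (1 + (χ i - γ i) / (γ i + R)) :=
      prod_congr rfl fun i _ => by rw [← neg_sub (γ i), neg_div, sub_eq_add_neg]
    have h4 := hsR.sum_le_tsum (range N) fun i _ => (div_pos (hd i) (hγR i)).le
    linarith
  obtain ⟨M₀, hM₀⟩ := eventually_atTop.1 (hγtop.eventually_ge_atTop (R + 4 * χ j))
  refine ⟨M₀, fun M hM => ?_⟩
  have htail : ∀ᶠ N in atTop, ∑ k ∈ range M, c N k / (γ k - χ j) ∈ Set.Icc (1 - ε / 2) 1 := by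
    filter_upwards [eventually_ge_atTop M, eventually_gt_atTop j] with N hN hjN
    have h1 := hexpand N (χ j) fun i => ne_of_interlacing hint i j
    have h2 : ∏ i ∈ range N, (1 + (χ i - γ i) / (γ i - χ j)) = 0 := by
      refine prod_eq_zero (mem_range.2 hjN) ?_
      rw [← neg_sub (γ j), neg_div, div_self (hd j).ne', add_neg_cancel]
    have hpos : ∀ k ∈ Ico M N, 0 < γ k - χ j := fun k hk => by
      linarith [hM₀ k (hM.trans (mem_Ico.1 hk).1), hχpos j]
    have h3 : 0 ≤ ∑ k ∈ Ico M N, c N k / (γ k - χ j) :=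
      sum_nonneg fun k hk => (div_pos (hcpos N k) (hpos k hk)).le
    have h4 : ∑ k ∈ Ico M N, c N k / (γ k - χ j) ≤ 4 * ∑ k ∈ range N, c N k / (γ k + R) := by
      rw [mul_sum]
      calc ∑ k ∈ Ico M N, c N k / (γ k - χ j) ≤ ∑ k ∈ Ico M N, 4 * (c N k / (γ k + R)) := by
            refine sum_le_sum fun k hk => ?_
            rw [mul_div_assoc', div_le_div_iff₀ (hpos k hk) (hγR k)]
            nlinarith [hM₀ k (hM.trans (mem_Ico.1 hk).1), hcpos N k, hγpos k, hχpos j]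
        _ ≤ ∑ k ∈ range N, 4 * (c N k / (γ k + R)) :=
            sum_le_sum_of_subset_of_nonneg
              (fun k hk => mem_range.2 (mem_Ico.1 hk).2)
              fun k _ _ => (mul_pos four_pos (div_pos (hcpos N k) (hγR k))).le
    have h5 := sum_range_add_sum_Ico (fun k => c N k / (γ k - χ j)) hN
    have h6 := hmass N
    exact ⟨by linarith, by linarith⟩
  have hmem := isClosed_Icc.mem_of_tendsto
    (tendsto_finsetSum (range M) fun k _ => (hlim k).div_const (γ k - χ j)) htail
  rw [Real.dist_eq, abs_lt]
  exact ⟨by linarith [hmem.1], by linarith [hmem.2]⟩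

end Interlacing



/-- Nazarov–Yuditskii theorem, case `C > 0`: for positive poles `γ_k ↑ ∞` and positive
points `χ` interlacing from below (`χ_k < γ_k < χ_{k+1}`), the `χ` arise as solutions of
`∑' ν_k/(γ_k - λ) = C` for some positive weights `ν` with `∑ ν_k/γ_k < ∞`
iff `∑ (γ_k/χ_k - 1) < ∞`. -/
theorem stmt_6 (γ χ : ℕ → ℝ) (hγ : StrictMono γ) (hγpos : ∀ k, 0 < γ k)
    (hγtop : Filter.Tendsto γ Filter.atTop Filter.atTop)
    (C : ℝ) (hC : 0 < C) (hχpos : ∀ k, 0 < χ k)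
    (hint : ∀ k, χ k < γ k ∧ γ k < χ (k + 1)) :
    (∃ ν : ℕ → ℝ, (∀ k, 0 < ν k) ∧ Summable (fun k => ν k / γ k) ∧
        ∀ j, (∑' k, ν k / (γ k - χ j)) = C)
      ↔ Summable (fun k => γ k / χ k - 1) := by
  constructor
  · rintro ⟨ν, hν, hνs, hνC⟩
    exact summable_of_exists_weights hγpos hC hχpos hint hν hνs hνC
  · intro hs
    obtain ⟨a, ha, has, haj⟩ := exists_weights_of_summable hγ hγpos hγtop hχpos hint hs
    refine ⟨fun k => C * a k, fun k => mul_pos hC (ha k), ?_, fun j => ?_⟩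
    · simpa only [mul_div_assoc] using has.mul_left C
    · simpa only [mul_div_assoc, mul_one] using ((haj j).mul_left C).tsum_eq
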